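/- Fix a, b ∈ Z^n and faces τ′, τ of N^n (i.e. subsets of {1,…,n}). Let F = k[a + Zτ′ + N^n] be the upset module over the poset Z^n for the upset a + Zτ′ + N^n, and let E = k[b + Zτ − N^n] be the downset module for the downset b + Zτ − N^n. Then Hom_{Z^n}(F, E) = 0 if (a + Zτ′ + N^n) ∩ (b + Zτ − N^n) = ∅, and Hom_{Z^n}(F, E) is a one-dimensional k-vector space if this intersection is nonempty. -/

import Mathlib

/-- The component of the indicator module `k[S]` in degree `q`: the field `k`
(as the full submodule of itself) if `q ∈ S`, and `0` otherwise. -/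
noncomputable def cmpt (k : Type) [Field k] {Q : Type} (S : Set Q) (q : Q) : Submodule k k :=
  haveI := Classical.dec (q ∈ S)
  if q ∈ S then ⊤ else ⊥

/-- The structure map of the indicator module `k[S]` for `q ≤ q'`:
the identity of `k` when `q, q' ∈ S`, and `0` otherwise. -/
noncomputable def stMap (k : Type) [Field k] {Q : Type} [PartialOrder Q] (S : Set Q)
    {q q' : Q} (h : q ≤ q') : ↥(cmpt k S q) →ₗ[k] ↥(cmpt k S q') :=
  haveI := Classical.dec (q ∈ S ∧ q' ∈ S)
  if hq : q ∈ S ∧ q' ∈ S then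
    Submodule.inclusion (by simp [cmpt, hq.1, hq.2])
  else 0

/-- The space of `Q`-module homomorphisms `k[S] → k[T]` between indicator modules:
families of linear maps in each degree commuting with the structure maps. -/
noncomputable def HomQ (k : Type) [Field k] {Q : Type} [PartialOrder Q] (S T : Set Q) :
    Submodule k (∀ q : Q, ↥(cmpt k S q) →ₗ[k] ↥(cmpt k T q)) where
  carrier := {φ | ∀ (q q' : Q) (h : q ≤ q'), stMap k T h ∘ₗ φ q = φ q' ∘ₗ stMap k S h}
  add_mem' := by
    intro a b ha hb
    simp only [Set.mem_setOf_eq] at ha hb ⊢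
    intro q q' h
    ext x
    have ha' := congrArg (fun g => g x) (ha q q' h)
    have hb' := congrArg (fun g => g x) (hb q q' h)
    simp only [LinearMap.comp_apply] at ha' hb' ⊢
    simp only [Pi.add_apply, LinearMap.add_apply, map_add, ha', hb']
  zero_mem' := by
    simp only [Set.mem_setOf_eq]
    intro q q' h
    ext x
    simp
  smul_mem' := by
    intro c a ha
    simp only [Set.mem_setOf_eq] at ha ⊢
    intro q q' h
    ext x
    have ha' := congrArg (fun g => g x) (ha q q' h)
    simp only [LinearMap.comp_apply] at ha' ⊢
    simp only [Pi.smul_apply, LinearMap.smul_apply, map_smul, ha']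

/-- The scalar by which a homomorphism of indicator modules acts in degree `q`. -/
noncomputable def scl {k : Type} [Field k] {Q : Type} {S T : Set Q}
    (φ : ∀ q : Q, ↥(cmpt k S q) →ₗ[k] ↥(cmpt k T q)) (q : Q) (hq : q ∈ S) : k :=
  (φ q ⟨1, by simp [cmpt, hq]⟩ : ↥(cmpt k T q)).1

/-- The set of connected components of a subset `S` of a poset: the quotient of `S`
by the equivalence relation generated by comparability (zigzag paths within `S`). -/
def Pi0 {Q : Type} [PartialOrder Q] (S : Set Q) : Type :=
  Quot (fun a b : S => (a : Q) ≤ (b : Q))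

open Pointwise

/-- `ℤτ ⊆ ℤⁿ`: the subgroup generated by the standard basis vectors indexed by the face
`τ ⊆ {1, …, n}`. -/
def ZTau (n : ℕ) (τ : Set (Fin n)) : Set (Fin n → ℤ) := {z | ∀ i, i ∉ τ → z i = 0}

/-- `ℕⁿ ⊆ ℤⁿ`: the positive cone of componentwise nonnegative vectors. -/
def NNn (n : ℕ) : Set (Fin n → ℤ) := {m | 0 ≤ m}

/-- The upset `a + ℤτ' + ℕⁿ` of `ℤⁿ`. -/
def upFlat {n : ℕ} (a : Fin n → ℤ) (τ' : Set (Fin n)) : Set (Fin n → ℤ) :=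
  ({a} : Set (Fin n → ℤ)) + ZTau n τ' + NNn n

/-- The downset `b + ℤτ − ℕⁿ` of `ℤⁿ`. -/
def downInj {n : ℕ} (b : Fin n → ℤ) (τ : Set (Fin n)) : Set (Fin n → ℤ) :=
  ({b} : Set (Fin n → ℤ)) + ZTau n τ - NNn n

lemma coe_eq_zero_of_notMem {k : Type} [Field k] {Q : Type} {S : Set Q} {q : Q} (hq : q ∉ S)
    (x : ↥(cmpt k S q)) : (x : k) = 0 := by
  have hx := x.2
  simpa [cmpt, hq] using hx

lemma coe_stMap {k : Type} [Field k] {Q : Type} [PartialOrder Q] {S : Set Q} {q q' : Q}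
    (h : q ≤ q') (hq : q ∈ S) (hq' : q' ∈ S) (x : ↥(cmpt k S q)) :
    (stMap k S h x : k) = x := by
  simp [stMap, hq, hq']

open Classical in
/-- The homomorphism `k[S] → k[T]` acting as the identity on `S ∩ T` and as zero elsewhere. -/
noncomputable def indicatorMap (k : Type) [Field k] {Q : Type} (S T : Set Q) (q : Q) :
    ↥(cmpt k S q) →ₗ[k] ↥(cmpt k T q) :=
  if hq : q ∈ S ∧ q ∈ T then Submodule.inclusion (by simp [cmpt, hq.1, hq.2]) else 0

lemma coe_indicatorMap {k : Type} [Field k] {Q : Type} {S T : Set Q} {q : Q}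
    (hS : q ∈ S) (hT : q ∈ T) (x : ↥(cmpt k S q)) :
    (indicatorMap k S T q x : k) = x := by
  simp [indicatorMap, hS, hT]

lemma indicatorMap_mem_HomQ (k : Type) [Field k] {Q : Type} [PartialOrder Q] {S T : Set Q}
    (hS : IsUpperSet S) (hT : IsLowerSet T) : indicatorMap k S T ∈ HomQ k S T := by
  intro q q' h
  ext x
  simp only [LinearMap.comp_apply]
  by_cases hq : q ∈ S
  · by_cases hq' : q' ∈ T
    · rw [coe_stMap h (hT h hq') hq', coe_indicatorMap hq (hT h hq'),
        coe_indicatorMap (hS h hq) hq', coe_stMap h hq (hS h hq)]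
    · rw [coe_eq_zero_of_notMem hq', coe_eq_zero_of_notMem hq']
  · rw [show x = 0 from Subtype.ext (coe_eq_zero_of_notMem hq x)]
    simp

lemma coe_apply_eq_scl_mul {k : Type} [Field k] {Q : Type} {S T : Set Q}
    (φ : ∀ q : Q, ↥(cmpt k S q) →ₗ[k] ↥(cmpt k T q)) {q : Q} (hq : q ∈ S)
    (x : ↥(cmpt k S q)) : (φ q x : k) = scl φ q hq * x := by
  have hx : x = (x : k) • (⟨1, by simp [cmpt, hq]⟩ : ↥(cmpt k S q)) := by
    ext; simp
  conv_lhs => rw [hx]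
  rw [map_smul, Submodule.coe_smul, smul_eq_mul, mul_comm]
  rfl

lemma scl_eq_of_le {k : Type} [Field k] {Q : Type} [PartialOrder Q] {S T : Set Q}
    {φ : ∀ q : Q, ↥(cmpt k S q) →ₗ[k] ↥(cmpt k T q)} (hφ : φ ∈ HomQ k S T) {q q' : Q}
    (h : q ≤ q') (hq : q ∈ S) (hq' : q' ∈ S) (hqT : q ∈ T) (hqT' : q' ∈ T) :
    scl φ q hq = scl φ q' hq' := by
  have key := congrArg (fun g => ((g ⟨1, by simp [cmpt, hq]⟩ : ↥(cmpt k T q')) : k)) (hφ q q' h)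
  simp only [LinearMap.comp_apply] at key
  rw [coe_stMap h hqT hqT', coe_apply_eq_scl_mul φ hq, coe_apply_eq_scl_mul φ hq',
    coe_stMap h hq hq'] at key
  simpa using key

lemma HomQ_eq_bot_of_inter_eq_empty (k : Type) [Field k] {Q : Type} [PartialOrder Q]
    {S T : Set Q} (h : S ∩ T = ∅) : HomQ k S T = ⊥ := by
  refine (Submodule.eq_bot_iff _).2 fun φ _ => ?_
  ext q x
  by_cases hq : q ∈ S
  · have hT : q ∉ T := fun hT => (h ▸ ⟨hq, hT⟩ : q ∈ (∅ : Set Q))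
    rw [coe_eq_zero_of_notMem hT, coe_eq_zero_of_notMem hT]
  · rw [show x = 0 from Subtype.ext (coe_eq_zero_of_notMem hq x)]
    simp

/-- If `S` is an upset and `T` a downset whose intersection is nonempty and directed, then
`Hom(k[S], k[T])` is one-dimensional. -/
lemma rank_HomQ_eq_one (k : Type) [Field k] {Q : Type} [PartialOrder Q] {S T : Set Q}
    (hS : IsUpperSet S) (hT : IsLowerSet T) (hne : (S ∩ T).Nonempty)
    (hdir : DirectedOn (· ≤ ·) (S ∩ T)) : Module.rank k ↥(HomQ k S T) = 1 := by
  obtain ⟨p, hpS, hpT⟩ := hne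
  let v : ↥(HomQ k S T) := ⟨indicatorMap k S T, indicatorMap_mem_HomQ k hS hT⟩
  have hbij : Function.Bijective (LinearMap.toSpanSingleton k ↥(HomQ k S T) v) := by
    refine ⟨fun c d hcd => ?_, fun φ => ?_⟩
    · have h1 := congrArg (fun ψ : ↥(HomQ k S T) =>
        ((ψ.1 p ⟨1, by simp [cmpt, hpS]⟩ : ↥(cmpt k T p)) : k)) hcd
      simpa [v, coe_indicatorMap hpS hpT] using h1
    · refine ⟨scl φ.1 p hpS, Subtype.ext ?_⟩
      ext q x
      by_cases hq : q ∈ S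
      · by_cases hqT : q ∈ T
        · obtain ⟨r, ⟨hrS, hrT⟩, hpr, hqr⟩ := hdir p ⟨hpS, hpT⟩ q ⟨hq, hqT⟩
          rw [coe_apply_eq_scl_mul φ.1 hq, scl_eq_of_le φ.2 hqr hq hrS hqT hrT,
            ← scl_eq_of_le φ.2 hpr hpS hrS hpT hrT]
          simp [v, coe_indicatorMap hq hqT]
        · rw [coe_eq_zero_of_notMem hqT, coe_eq_zero_of_notMem hqT]
      · rw [show x = 0 from Subtype.ext (coe_eq_zero_of_notMem hq x)]
        simp
  exact (LinearEquiv.ofBijective _ hbij).rank_eq.symm.trans (Module.rank_self k)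

lemma mem_upFlat {n : ℕ} {a : Fin n → ℤ} {τ' : Set (Fin n)} {q : Fin n → ℤ} :
    q ∈ upFlat a τ' ↔ ∀ i, i ∉ τ' → a i ≤ q i := by
  classical
  constructor
  · rintro ⟨_, ⟨_, rfl, z, hz, rfl⟩, m, hm, rfl⟩ i hi
    have hmi : 0 ≤ m i := hm i
    have hzi : z i = 0 := hz i hi
    simp only [Pi.add_apply]
    omega
  · intro h
    refine ⟨_, ⟨a, rfl, fun i => if i ∈ τ' then q i - a i else 0, fun i hi => if_neg hi, rfl⟩,
      fun i => if i ∈ τ' then 0 else q i - a i, fun i => ?_, ?_⟩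
    · by_cases hi : i ∈ τ'
      · simp [hi]
      · simpa [hi] using h i hi
    · ext i
      by_cases hi : i ∈ τ' <;> simp [hi]

lemma mem_downInj {n : ℕ} {b : Fin n → ℤ} {τ : Set (Fin n)} {q : Fin n → ℤ} :
    q ∈ downInj b τ ↔ ∀ i, i ∉ τ → q i ≤ b i := by
  classical
  constructor
  · rintro ⟨_, ⟨_, rfl, z, hz, rfl⟩, m, hm, rfl⟩ i hi
    have hmi : 0 ≤ m i := hm i
    have hzi : z i = 0 := hz i hi
    simp only [Pi.add_apply, Pi.sub_apply]
    omega
  · intro h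
    refine ⟨_, ⟨b, rfl, fun i => if i ∈ τ then q i - b i else 0, fun i hi => if_neg hi, rfl⟩,
      fun i => if i ∈ τ then 0 else b i - q i, fun i => ?_, ?_⟩
    · by_cases hi : i ∈ τ
      · simp [hi]
      · simpa [hi] using h i hi
    · ext i
      by_cases hi : i ∈ τ <;> simp [hi]

lemma isUpperSet_upFlat {n : ℕ} (a : Fin n → ℤ) (τ' : Set (Fin n)) :
    IsUpperSet (upFlat a τ') := fun _ _ h hp =>
  mem_upFlat.2 fun i hi => (mem_upFlat.1 hp i hi).trans (h i)

lemma isLowerSet_downInj {n : ℕ} (b : Fin n → ℤ) (τ : Set (Fin n)) :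
    IsLowerSet (downInj b τ) := fun _ _ h hp =>
  mem_downInj.2 fun i hi => (h i).trans (mem_downInj.1 hp i hi)

lemma directedOn_upFlat_inter_downInj {n : ℕ} (a b : Fin n → ℤ) (τ' τ : Set (Fin n)) :
    DirectedOn (· ≤ ·) (upFlat a τ' ∩ downInj b τ) := fun p hp q hq =>
  ⟨p ⊔ q, ⟨isUpperSet_upFlat a τ' le_sup_left hp.1,
    mem_downInj.2 fun i hi => sup_le (mem_downInj.1 hp.2 i hi) (mem_downInj.1 hq.2 i hi)⟩,
    le_sup_left, le_sup_right⟩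

/-- Fix `a, b ∈ ℤⁿ` and faces `τ', τ` of `ℕⁿ`.  Let
`F = k[a + ℤτ' + ℕⁿ]` be the corresponding upset module and `E = k[b + ℤτ − ℕⁿ]` the
corresponding downset module over the poset `ℤⁿ`.  Then `Hom_{ℤⁿ}(F, E) = 0` if
`(a + ℤτ' + ℕⁿ) ∩ (b + ℤτ − ℕⁿ) = ∅`, and `Hom_{ℤⁿ}(F, E)` is a one-dimensional
`k`-vector space otherwise. -/
theorem hom_flat_into_injective (k : Type) [Field k] (n : ℕ)
    (a b : Fin n → ℤ) (τ' τ : Set (Fin n)) :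
    (upFlat a τ' ∩ downInj b τ = ∅ →
      HomQ k (upFlat a τ') (downInj b τ) = ⊥) ∧
    ((upFlat a τ' ∩ downInj b τ).Nonempty →
      Module.rank k ↥(HomQ k (upFlat a τ') (downInj b τ)) = 1) := by
  exact ⟨HomQ_eq_bot_of_inter_eq_empty k, fun h =>
    rank_HomQ_eq_one k (isUpperSet_upFlat a τ') (isLowerSet_downInj b τ) h
      (directedOn_upFlat_inter_downInj a b τ' τ)⟩
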